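/- arXiv:0707.0366 — 4 statements merged into one kernel-verified Lean document; each statement's English description precedes it below -/
import Mathlib

section
/- Fix null vectors w₀, w₃ ∈ ℂ⁴ with ⟨w₀, w₃⟩ = i. For any two elements w, w′ ∈ Σ_{w₃}, one has P(w) = P(w′) if and only if w − w′ = s·w₃ for some real number s. In particular, for every w ∈ Σ_{w₃} and every s ∈ ℝ, the vector w + s·w₃ again lies in Σ_{w₃}: the fibers of P are real lines parallel to w₃. -/
open Complex ComplexConjugate

/-- The Hermitian form of signature (3,1) on `ℂ⁴`. -/
noncomputable def herm (z w : Fin 4 → ℂ) : ℂ :=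
  z 1 * conj (w 1) + z 2 * conj (w 2) + Complex.I * (z 0 * conj (w 3) - z 3 * conj (w 0))

/-- The stereographic projection `P(w) = w − w₀ − i·⟨w, w₀⟩·w₃`. -/
noncomputable def Pmap (w₀ w₃ : Fin 4 → ℂ) (w : Fin 4 → ℂ) : Fin 4 → ℂ :=
  w - w₀ - (Complex.I * herm w w₀) • w₃

theorem herm_add_smul_left (z u w : Fin 4 → ℂ) (c : ℂ) :
    herm (z + c • u) w = herm z w + c * herm u w := by
  simp only [herm, Pi.add_apply, Pi.smul_apply, smul_eq_mul]
  ring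

theorem herm_conj (z w : Fin 4 → ℂ) : herm w z = conj (herm z w) := by
  simp only [herm, map_add, map_mul, map_sub, Complex.conj_conj, Complex.conj_I]
  ring

theorem herm_self_add_smul (w u : Fin 4 → ℂ) (c : ℂ) (hu : herm u u = 0)
    (hw : herm w w = 0) (hwu : herm w u = Complex.I) :
    herm (w + c • u) (w + c • u) = Complex.I * (conj c - c) := by
  have huw : herm u w = -Complex.I := by rw [herm_conj w u, hwu, Complex.conj_I]
  rw [herm_add_smul_left, herm_conj (w + c • u) w, herm_conj (w + c • u) u,
    herm_add_smul_left, herm_add_smul_left, hw, huw, hwu, hu]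
  simp
  ring

/-- For `w, w′ ∈ Σ_{w₃}`, `P(w) = P(w′)` iff `w − w′ = s·w₃` for some real `s`;
moreover `Σ_{w₃}` is stable under translation by real multiples of `w₃`:
the fibers of `P` are real lines parallel to `w₃`. -/
theorem stmt_5 (w₀ w₃ : Fin 4 → ℂ) (h₀ : herm w₀ w₀ = 0) (h₃ : herm w₃ w₃ = 0)
    (h₀₃ : herm w₀ w₃ = Complex.I) :
    (∀ w w' : Fin 4 → ℂ, herm w w = 0 → herm w w₃ = Complex.I →
      herm w' w' = 0 → herm w' w₃ = Complex.I →
      (Pmap w₀ w₃ w = Pmap w₀ w₃ w' ↔ ∃ s : ℝ, w - w' = (s : ℂ) • w₃)) ∧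
    (∀ w : Fin 4 → ℂ, herm w w = 0 → herm w w₃ = Complex.I → ∀ s : ℝ,
      herm (w + (s : ℂ) • w₃) (w + (s : ℂ) • w₃) = 0 ∧
      herm (w + (s : ℂ) • w₃) w₃ = Complex.I) := by
  have h₃₀ : herm w₃ w₀ = -Complex.I := by rw [herm_conj w₀ w₃, h₀₃, Complex.conj_I]
  refine ⟨fun w w' hw hw3 hw' hw3' => ⟨fun h => ?_, ?_⟩, fun w hw hw3 s => ⟨?_, ?_⟩⟩
  · obtain ⟨c, hc⟩ : ∃ c : ℂ, w = w' + c • w₃ := by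
      refine ⟨Complex.I * herm w w₀ - Complex.I * herm w' w₀, ?_⟩
      funext k
      have hk := congrFun h k
      simp only [Pmap, Pi.add_apply, Pi.sub_apply, Pi.smul_apply, smul_eq_mul] at hk ⊢
      linear_combination hk
    have h1 := herm_self_add_smul w' w₃ c h₃ hw' hw3'
    rw [← hc, hw] at h1
    have h2 : conj c = c := by
      rcases mul_eq_zero.mp h1.symm with h | h
      · exact absurd h Complex.I_ne_zero
      · exact sub_eq_zero.mp h
    obtain ⟨s, hs⟩ := Complex.conj_eq_iff_real.mp h2
    exact ⟨s, by rw [← hs]; nth_rewrite 1 [hc]; simp⟩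
  · rintro ⟨s, hs⟩
    have hc : w = w' + (s : ℂ) • w₃ := by rw [← hs]; simp
    have h1 : herm w w₀ = herm w' w₀ + s * -Complex.I := by
      rw [hc, herm_add_smul_left, h₃₀]
    unfold Pmap
    rw [h1]
    funext k
    have hk := congrFun hc k
    simp only [Pi.add_apply, Pi.sub_apply, Pi.smul_apply, smul_eq_mul] at hk ⊢
    linear_combination hk + s * w₃ k * Complex.I_mul_I
  · rw [herm_self_add_smul w w₃ _ h₃ hw hw3]
    simp
  · rw [herm_add_smul_left, h₃, hw3]
    simp
end

section
/- Let a ∈ ℂ with a ≠ 0, c ∈ ℂ, v ∈ ℂ², and A a unitary 2×2 complex matrix, subject to the conditions a⁻¹·conj(a)·det A = 1 and |v|² = i·(conj(a)·conj(c) − a·c). Let g be the 4×4 complex matrix written in block form (with blocks of sizes 1, 2, 1) as g = [[a⁻¹, i·a⁻¹·(conj(v)ᵀ A), c], [0, A, v], [0, 0, conj(a)]]. Then det g = 1, g preserves the Hermitian form (⟨g·z, g·w⟩ = ⟨z, w⟩ for all z, w ∈ ℂ⁴), and g·e₀ = a⁻¹·e₀, where e₀ = (1, 0, 0, 0); in particular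 g belongs to SU(3,1) and stabilizes the null line ℂ·e₀. -/
open Complex ComplexConjugate

/-- A matrix of the block form `[[a⁻¹, i·a⁻¹·v̄ᵀA, c], [0, A, v], [0, 0, ā]]`
(blocks of sizes 1, 2, 1) with `A` unitary, `a⁻¹·ā·det A = 1`,
`|v|² = i·(ā·c̄ − a·c)`, has determinant 1, preserves the Hermitian form, and
sends `e₀ = (1,0,0,0)` to `a⁻¹·e₀`; i.e. it lies in `SU(3,1)` and stabilizes `ℂ·e₀`. -/
theorem stmt_9 (a c : ℂ) (ha : a ≠ 0) (v : Fin 2 → ℂ) (A : Matrix (Fin 2) (Fin 2) ℂ)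
    (hA : A ∈ Matrix.unitaryGroup (Fin 2) ℂ)
    (hdet : a⁻¹ * conj a * A.det = 1)
    (hv : v 0 * conj (v 0) + v 1 * conj (v 1) = Complex.I * (conj a * conj c - a * c))
    (g : Matrix (Fin 4) (Fin 4) ℂ)
    (hg : g = !![a⁻¹, Complex.I * a⁻¹ * (conj (v 0) * A 0 0 + conj (v 1) * A 1 0),
                  Complex.I * a⁻¹ * (conj (v 0) * A 0 1 + conj (v 1) * A 1 1), c;
                 0, A 0 0, A 0 1, v 0;
                 0, A 1 0, A 1 1, v 1;
                 0, 0, 0, conj a]) :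
    g.det = 1 ∧
    (∀ z w : Fin 4 → ℂ, herm (g.mulVec z) (g.mulVec w) = herm z w) ∧
    g.mulVec ![1, 0, 0, 0] = a⁻¹ • ![1, 0, 0, 0] := by
  have hab : a * a⁻¹ = 1 := mul_inv_cancel₀ ha
  have hBb : conj a * (conj a)⁻¹ = 1 := mul_inv_cancel₀ (by simpa using ha)
  have hU := Matrix.mem_unitaryGroup_iff'.mp hA
  have u00 := congrFun (congrFun hU 0) 0
  have u01 := congrFun (congrFun hU 0) 1
  have u10 := congrFun (congrFun hU 1) 0
  have u11 := congrFun (congrFun hU 1) 1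
  simp [Matrix.mul_apply, Fin.sum_univ_two, Matrix.star_apply] at u00 u01 u10 u11
  subst hg
  refine ⟨?_, ?_, ?_⟩
  · rw [Matrix.det_fin_two] at hdet
    simp [Matrix.det_succ_row_zero, Fin.sum_univ_succ, Fin.succAbove]
    linear_combination hdet
  · intro z w
    simp only [herm, Matrix.mulVec, dotProduct, Fin.sum_univ_four]
    simp
    linear_combination z 1 * conj (w 1) * u00 + z 2 * conj (w 1) * u01
      + z 1 * conj (w 2) * u10 + z 2 * conj (w 2) * u11 + z 3 * conj (w 3) * hv
      + I * (z 0 + I * ((conj (v 0) * A 0 0 + conj (v 1) * A 1 0) * z 1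
          + (conj (v 0) * A 0 1 + conj (v 1) * A 1 1) * z 2)) * conj (w 3) * hab
      - I * z 3 * (conj (w 0) - I * ((v 0 * conj (A 0 0) + v 1 * conj (A 1 0)) * conj (w 1)
          + (v 0 * conj (A 0 1) + v 1 * conj (A 1 1)) * conj (w 2))) * hBb
      + (((conj (v 0) * A 0 0 + conj (v 1) * A 1 0) * z 1
          + (conj (v 0) * A 0 1 + conj (v 1) * A 1 1) * z 2) * conj (w 3)
        + z 3 * ((v 0 * conj (A 0 0) + v 1 * conj (A 1 0)) * conj (w 1)
          + (v 0 * conj (A 0 1) + v 1 * conj (A 1 1)) * conj (w 2))) * I_mul_I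
  · ext i
    fin_cases i <;> simp [Matrix.mulVec, dotProduct, Fin.sum_univ_four]
end

section
/- (Local holomorphicity of the quartic differential Φ) Let U ⊆ ℂ be open and let ν, h, p, q : ℂ → ℂ be smooth functions on U satisfying on U the system ∂̄h = −p, ∂̄p = −ν·h − q, ∂̄q = −ν·p. Then the function h·q − (1/2)·p² satisfies ∂̄(h·q − (1/2)·p²) = 0 on U, and hence is holomorphic on U. (This is the local coordinate form of the statement that for a Willmore Legendrian surface the complex quartic differential Φ = (hq − ½p²)ω⁴ is holomorphic.) -/
open Complex

/-- The Cauchy–Riemann operator: `∂̄f(z) = (1/2)·(Df(z)(1) + i·Df(z)(i))`, where `Df(z)`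
is the real Fréchet derivative of `f` at `z`. -/
noncomputable def dbar (f : ℂ → ℂ) (z : ℂ) : ℂ :=
  (1 / 2 : ℂ) * (fderiv ℝ f z 1 + Complex.I * fderiv ℝ f z Complex.I)

/-- Local holomorphicity of the quartic differential `Φ`: if smooth `ν, h, p, q` satisfy
`∂̄h = −p`, `∂̄p = −ν·h − q`, `∂̄q = −ν·p` on an open set `U`, then `h·q − (1/2)·p²`
satisfies `∂̄(h·q − ½p²) = 0` on `U`, hence is holomorphic on `U`. -/
theorem stmt_12 (U : Set ℂ) (hU : IsOpen U) (ν h p q : ℂ → ℂ)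
    (hν : ContDiffOn ℝ (⊤ : ℕ∞) ν U) (hh : ContDiffOn ℝ (⊤ : ℕ∞) h U)
    (hp : ContDiffOn ℝ (⊤ : ℕ∞) p U) (hq : ContDiffOn ℝ (⊤ : ℕ∞) q U)
    (eh : ∀ z ∈ U, dbar h z = -p z)
    (ep : ∀ z ∈ U, dbar p z = -(ν z * h z) - q z)
    (eq : ∀ z ∈ U, dbar q z = -(ν z * p z)) :
    (∀ z ∈ U, dbar (fun w => h w * q w - (1 / 2 : ℂ) * (p w) ^ 2) z = 0) ∧
    DifferentiableOn ℂ (fun w => h w * q w - (1 / 2 : ℂ) * (p w) ^ 2) U := by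
  have key : ∀ z ∈ U, DifferentiableAt ℝ (fun w => h w * q w - (1 / 2 : ℂ) * (p w) ^ 2) z ∧
      dbar (fun w => h w * q w - (1 / 2 : ℂ) * (p w) ^ 2) z = 0 := by
    intro z hz
    have dh := ((hh.contDiffAt (hU.mem_nhds hz)).differentiableAt (by simp)).hasFDerivAt
    have dp := ((hp.contDiffAt (hU.mem_nhds hz)).differentiableAt (by simp)).hasFDerivAt
    have dq := ((hq.contDiffAt (hU.mem_nhds hz)).differentiableAt (by simp)).hasFDerivAt
    have d := (dh.mul dq).sub ((dp.pow 2).const_mul (1 / 2 : ℂ))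
    have d' : HasFDerivAt (fun w => h w * q w - (1 / 2 : ℂ) * (p w) ^ 2) _ z := d
    refine ⟨d'.differentiableAt, ?_⟩
    have h1 := eh z hz
    have h2 := ep z hz
    have h3 := eq z hz
    unfold dbar at h1 h2 h3 ⊢
    rw [d'.fderiv]
    simp
    linear_combination 2 * (q z * h1 + h z * h3 - p z * h2)
  refine ⟨fun z hz => (key z hz).2, fun z hz => ?_⟩
  obtain ⟨hd, hb⟩ := key z hz
  refine (differentiableAt_complex_iff_differentiableAt_real.2 ⟨hd, ?_⟩).differentiableWithinAt
  unfold dbar at hb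
  rw [smul_eq_mul]
  linear_combination (-2 * Complex.I) * hb + fderiv ℝ _ z Complex.I * Complex.I_mul_I
end

section
/- (Proposition 2.2, local form) Let U ⊆ ℂ be a connected open set and let ν, h, p, q : ℂ → ℂ be smooth functions on U satisfying on U the system ∂̄h = −p, ∂̄p = −ν·h − q, ∂̄q = −ν·p, together with the identity h·q − (1/2)·p² = 0 on U. Then either h vanishes identically on U, or the zero set { z ∈ U : h(z) = 0 } has empty interior in U. (This is the local coordinate form of the statement that for a connected Willmore Legendrian surface with Φ ≡ 0, either the surface is totally umbilic or the umbilic locus is a closed subset with no interior.) -/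
open Complex

open Filter Topology

section aux
variable {E : Type*} [NormedAddCommGroup E] [NormedSpace ℂ E]

lemma aux_lin (L : ℂ →L[ℝ] E) (t : ℝ) :
    L (exp (t * I)) = exp (-(t * I)) • (L 1 + I • L I) - I • L (exp (t * I) * I) := by
  have e1 : exp (t * I) = (Real.cos t) • (1 : ℂ) + (Real.sin t) • I := by
    rw [exp_mul_I]; simp
  have e2 : exp (t * I) * I = (Real.cos t) • I - (Real.sin t) • (1 : ℂ) := by
    rw [exp_mul_I]; simp [add_mul, mul_assoc]; ring
  have e3 : exp (-(t * I)) = Real.cos t - Real.sin t * I := by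
    rw [← neg_mul, exp_mul_I]; simp; ring
  rw [e2, e1, e3]
  simp only [map_add, map_sub, map_smul]
  generalize Real.cos t = c
  generalize Real.sin t = s
  generalize L 1 = x
  generalize L I = y
  simp only [← Complex.coe_smul]
  have hI : I * I = -1 := I_mul_I
  match_scalars
  · ring
  · linear_combination (s : ℂ) * hI

lemma aux_mean [CompleteSpace E] (v : ℂ → E) (hv : ContDiff ℝ 1 v) (z₀ : ℂ) (R K : ℝ) (hR : 0 < R)
    (hsupp : ∀ z, R ≤ ‖z - z₀‖ → v z = 0)
    (hK : ∀ z, ‖fderiv ℝ v z 1 + I • fderiv ℝ v z I‖ ≤ K) (w : ℂ) :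
    ‖v w‖ ≤ 2 * R * K := by
  have hK0 : 0 ≤ K := (norm_nonneg _).trans (hK 0)
  by_cases hw : R ≤ ‖w - z₀‖
  · rw [hsupp w hw]; simp; positivity
  push Not at hw
  have hcs : HasCompactSupport v := by
    apply HasCompactSupport.of_support_subset_isCompact (isCompact_closedBall z₀ R)
    intro z hz
    by_contra h
    rw [Metric.mem_closedBall, dist_eq_norm] at h
    exact hz (hsupp z (by linarith))
  have hdc : Continuous (fderiv ℝ v) := hv.continuous_fderiv (by norm_num)
  obtain ⟨C, hC⟩ := (hcs.fderiv ℝ).exists_bound_of_continuous hdc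
  have hvd : Differentiable ℝ v := hv.differentiable (by norm_num)
  have hvc := hv.continuous
  set m : ℝ → E := fun r => ∫ t in (0:ℝ)..(2 * Real.pi), v (w + r * exp (t * I)) with hm
  have hder : ∀ r : ℝ, HasDerivAt m
      (∫ t in (0:ℝ)..(2 * Real.pi), fderiv ℝ v (w + r * exp (t * I)) (exp (t * I))) r := by
    intro r
    refine (intervalIntegral.hasDerivAt_integral_of_dominated_loc_of_deriv_le
      (F := fun (r : ℝ) (t : ℝ) => v (w + r * exp (t * I)))
      (F' := fun (r : ℝ) (t : ℝ) => fderiv ℝ v (w + r * exp (t * I)) (exp (t * I)))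
      (bound := fun _ => C) (s := Set.univ) (Filter.univ_mem) ?_ ?_ ?_ ?_ ?_ ?_).2
    · exact Filter.Eventually.of_forall fun r => Continuous.aestronglyMeasurable (by fun_prop)
    · exact Continuous.intervalIntegrable (by fun_prop) _ _
    · exact Continuous.aestronglyMeasurable (by fun_prop)
    · refine Filter.Eventually.of_forall fun t _ x _ => ?_
      refine (ContinuousLinearMap.le_opNorm _ _).trans ?_
      rw [norm_exp_ofReal_mul_I, mul_one]
      exact hC _
    · exact intervalIntegrable_const
    · refine Filter.Eventually.of_forall fun t _ x _ => ?_
      have h1 : HasDerivAt (fun x : ℝ => w + x * exp (t * I)) (exp (t * I)) x := by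
        simpa using ((hasDerivAt_id x).ofReal_comp.mul_const (exp (t * I))).const_add w
      exact (hvd _).hasFDerivAt.comp_hasDerivAt x h1
  have hexp : ∀ t : ℝ, HasDerivAt (fun t : ℝ => exp (t * I)) (exp (t * I) * I) t := by
    intro t
    simpa using ((hasDerivAt_id t).ofReal_comp.mul_const I).cexp
  have hzero : ∀ r : ℝ,
      ∫ t in (0:ℝ)..(2 * Real.pi), fderiv ℝ v (w + r * exp (t * I)) (exp (t * I) * I) = 0 := by
    intro r
    by_cases hr : r = 0
    · subst hr
      have := intervalIntegral.integral_eq_sub_of_hasDerivAt (a := 0) (b := 2 * Real.pi)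
        (f := fun t : ℝ => fderiv ℝ v w (exp (t * I)))
        (f' := fun t : ℝ => fderiv ℝ v w (exp (t * I) * I))
        (fun t _ => (fderiv ℝ v w).hasFDerivAt.comp_hasDerivAt t (hexp t))
        (Continuous.intervalIntegrable (by fun_prop) _ _)
      simpa using this
    · have := intervalIntegral.integral_eq_sub_of_hasDerivAt (a := 0) (b := 2 * Real.pi)
        (f := fun t : ℝ => v (w + r * exp (t * I)))
        (f' := fun t : ℝ => r • fderiv ℝ v (w + r * exp (t * I)) (exp (t * I) * I))
        (fun t _ => by
          have h1 : HasDerivAt (fun t : ℝ => w + r * exp (t * I)) (r • (exp (t * I) * I)) t := by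
            simpa using ((hexp t).const_mul (r : ℂ)).const_add w
          have := (hvd _).hasFDerivAt.comp_hasDerivAt t h1
          rw [map_smul] at this
          exact this)
        (Continuous.intervalIntegrable (by fun_prop) _ _)
      rw [intervalIntegral.integral_smul] at this
      simp at this
      exact this.resolve_left hr
  have hbound : ∀ r : ℝ,
      ‖∫ t in (0:ℝ)..(2 * Real.pi), fderiv ℝ v (w + r * exp (t * I)) (exp (t * I))‖
        ≤ K * (2 * Real.pi) := by
    intro r
    have : ∫ t in (0:ℝ)..(2 * Real.pi), fderiv ℝ v (w + r * exp (t * I)) (exp (t * I))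
        = ∫ t in (0:ℝ)..(2 * Real.pi), exp (-(t * I)) •
          (fderiv ℝ v (w + r * exp (t * I)) 1 + I • fderiv ℝ v (w + r * exp (t * I)) I) := by
      simp_rw [fun t : ℝ => aux_lin (fderiv ℝ v (w + r * exp (t * I))) t]
      rw [intervalIntegral.integral_sub, intervalIntegral.integral_smul, hzero]
      · simp
      · exact Continuous.intervalIntegrable (by fun_prop) _ _
      · exact Continuous.intervalIntegrable (by fun_prop) _ _
    rw [this]
    have := intervalIntegral.norm_integral_le_of_norm_le_const (a := 0) (b := 2 * Real.pi) (C := K)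
      (f := fun t : ℝ => exp (-(t * I)) •
          (fderiv ℝ v (w + r * exp (t * I)) 1 + I • fderiv ℝ v (w + r * exp (t * I)) I))
      (fun t _ => by
        rw [norm_smul]
        have : ‖exp (-(t * I))‖ = 1 := by
          have := norm_exp_ofReal_mul_I (-t)
          simpa using this
        rw [this, one_mul]; exact hK _)
    rwa [sub_zero, abs_of_pos Real.two_pi_pos] at this
  have hmv := norm_image_sub_le_of_norm_deriv_le_segment' (f := m) (a := 0) (b := 2 * R)
    (fun x _ => (hder x).hasDerivWithinAt) (fun x _ => hbound x) (2 * R)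
    (Set.right_mem_Icc.2 (by positivity))
  have hm0 : m 0 = (2 * Real.pi) • v w := by simp [hm]
  have hm1 : m (2 * R) = 0 := by
    rw [hm]
    have : ∀ t : ℝ, v (w + (2 * R : ℝ) * exp (t * I)) = 0 := by
      intro t
      apply hsupp
      have h1 : ‖((2 * R : ℝ) : ℂ) * exp (t * I)‖ = 2 * R := by
        rw [norm_mul, norm_exp_ofReal_mul_I, norm_real, Real.norm_eq_abs,
          abs_of_pos (by positivity), mul_one]
      have h2 := norm_sub_norm_le (((2 * R : ℝ) : ℂ) * exp (t * I)) (-(w - z₀))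
      rw [norm_neg, h1] at h2
      have h3 : w + ((2 * R : ℝ) : ℂ) * exp (t * I) - z₀
        = ((2 * R : ℝ) : ℂ) * exp (t * I) - -(w - z₀) := by ring
      rw [h3]; linarith
    simp only [this]; simp
  rw [hm0, hm1, zero_sub, norm_neg, norm_smul, Real.norm_eq_abs, abs_of_pos Real.two_pi_pos] at hmv
  have : 2 * Real.pi * ‖v w‖ ≤ 2 * Real.pi * (2 * R * K) := by linarith
  exact le_of_mul_le_mul_left this Real.two_pi_pos

lemma aux_uc [CompleteSpace E] (u : ℂ → E) (hu : ContDiff ℝ 1 u) (z₀ : ℂ) (R r M : ℝ) (hR : 0 < R)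
    (hr : 0 < r) (hRM : 4 * R * M ≤ 1) (hM : 0 ≤ M)
    (hsupp : ∀ z, R ≤ ‖z - z₀‖ → u z = 0)
    (h0 : ∀ᶠ z in 𝓝 z₀, u z = 0)
    (hd : ∀ z, ‖z - z₀‖ < r → ‖fderiv ℝ u z 1 + I • fderiv ℝ u z I‖ ≤ M * ‖u z‖)
    (w : ℂ) (hw : ‖w - z₀‖ < r) : u w = 0 := by
  by_cases hwz : w = z₀
  · rw [hwz]; exact h0.self_of_nhds
  have hcs : HasCompactSupport u := by
    apply HasCompactSupport.of_support_subset_isCompact (isCompact_closedBall z₀ R)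
    intro z hz
    by_contra h
    rw [Metric.mem_closedBall, dist_eq_norm] at h
    exact hz (hsupp z (by linarith))
  have hdc : Continuous (fderiv ℝ u) := hu.continuous_fderiv (by norm_num)
  have hud : Differentiable ℝ u := hu.differentiable (by norm_num)
  obtain ⟨C₀, hC₀⟩ := (hcs.fderiv ℝ).exists_bound_of_continuous hdc
  obtain ⟨C, hC0, hC⟩ : ∃ C, 0 ≤ C ∧ ∀ z, ‖fderiv ℝ u z 1 + I • fderiv ℝ u z I‖ ≤ C := by
    have hh : ∀ z, ‖fderiv ℝ u z 1 + I • fderiv ℝ u z I‖ ≤ C₀ + C₀ := by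
      intro z
      refine (norm_add_le _ _).trans (add_le_add ?_ ?_)
      · refine (ContinuousLinearMap.le_opNorm _ _).trans ?_
        simpa using hC₀ z
      · rw [norm_smul, norm_I, one_mul]
        refine (ContinuousLinearMap.le_opNorm _ _).trans ?_
        simpa using hC₀ z
    exact ⟨_, (norm_nonneg _).trans (hh 0), hh⟩
  have key : ∀ n : ℕ, ‖u w‖ ≤ 4 * R * C * (‖w - z₀‖ / r) ^ n := by
    intro n
    set v : ℂ → E := fun z => ((z - z₀) ^ n)⁻¹ • u z with hv
    have hv0 : v =ᶠ[𝓝 z₀] fun _ => 0 := by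
      filter_upwards [h0] with z hz
      simp [hv, hz]
    have hvC : ContDiff ℝ 1 v := by
      rw [contDiff_iff_contDiffAt]
      intro z
      by_cases hz : z = z₀
      · rw [hz]; exact contDiffAt_const.congr_of_eventuallyEq hv0
      · have : (z - z₀) ^ n ≠ 0 := pow_ne_zero _ (sub_ne_zero.2 hz)
        exact ContDiffAt.smul (ContDiffAt.inv (by fun_prop) this) hu.contDiffAt
    have hvs : ∀ z, R ≤ ‖z - z₀‖ → v z = 0 := fun z hz => by simp [hv, hsupp z hz]
    have hvcs : HasCompactSupport v := hcs.smul_left (f := fun z => ((z - z₀) ^ n)⁻¹)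
    obtain ⟨z₁, hz₁⟩ := hvC.continuous.norm.exists_forall_ge_of_hasCompactSupport hvcs.norm
    have hdv : ∀ z, z ≠ z₀ → fderiv ℝ v z 1 + I • fderiv ℝ v z I
        = ((z - z₀) ^ n)⁻¹ • (fderiv ℝ u z 1 + I • fderiv ℝ u z I) := by
      intro z hz
      have hne : (z - z₀) ^ n ≠ 0 := pow_ne_zero _ (sub_ne_zero.2 hz)
      have hg : DifferentiableAt ℂ (fun z : ℂ => ((z - z₀) ^ n)⁻¹) z :=
        DifferentiableAt.inv (by fun_prop) hne
      have hg' := (hg.hasFDerivAt.restrictScalars ℝ).smul (hud z).hasFDerivAt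
      have e : fderiv ℝ v z = _ := hg'.fderiv
      have e2 : fderiv ℂ (fun z : ℂ => ((z - z₀) ^ n)⁻¹) z I
          = I * fderiv ℂ (fun z : ℂ => ((z - z₀) ^ n)⁻¹) z 1 := by
        rw [← smul_eq_mul, ← map_smul]; simp
      rw [e]
      simp only [_root_.add_apply, _root_.smul_apply,
        ContinuousLinearMap.smulRight_apply, ContinuousLinearMap.coe_restrictScalars', e2]
      generalize fderiv ℂ (fun z : ℂ => ((z - z₀) ^ n)⁻¹) z 1 = d
      have hI : I * I = -1 := I_mul_I
      match_scalars
      · ring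
      · linear_combination d * hI
      · ring
    have hb : ∀ z, ‖fderiv ℝ v z 1 + I • fderiv ℝ v z I‖ ≤ M * ‖v z₁‖ + (r ^ n)⁻¹ * C := by
      intro z
      by_cases hz : z = z₀
      · have : fderiv ℝ v z = 0 := by
          rw [hz, hv0.fderiv_eq]; simp
        rw [this]; simp; positivity
      rw [hdv z hz, norm_smul]
      by_cases hzr : ‖z - z₀‖ < r
      · have h1 : ‖v z‖ = ‖((z - z₀) ^ n)⁻¹‖ * ‖u z‖ := norm_smul _ _
        calc _ ≤ ‖((z - z₀) ^ n)⁻¹‖ * (M * ‖u z‖) := by gcongr; exact hd z hzr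
          _ = M * ‖v z‖ := by rw [h1]; ring
          _ ≤ M * ‖v z₁‖ := by gcongr; exact hz₁ z
          _ ≤ _ := by linarith [show 0 ≤ (r ^ n)⁻¹ * C by positivity]
      · push Not at hzr
        have : ‖((z - z₀) ^ n)⁻¹‖ ≤ (r ^ n)⁻¹ := by
          rw [norm_inv, norm_pow]; gcongr
        calc _ ≤ (r ^ n)⁻¹ * C := by gcongr; exact hC z
          _ ≤ _ := by linarith [show 0 ≤ M * ‖v z₁‖ by positivity]
    have hmain := aux_mean v hvC z₀ R _ hR hvs hb z₁
    have hS : ‖v z₁‖ ≤ 4 * R * ((r ^ n)⁻¹ * C) := by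
      nlinarith [norm_nonneg (v z₁)]
    have hwv : ‖v w‖ = (‖w - z₀‖ ^ n)⁻¹ * ‖u w‖ := by
      rw [hv]; simp only [norm_smul, norm_inv, norm_pow]
    have hle := (hz₁ w).trans hS
    have hpos : 0 < ‖w - z₀‖ ^ n := pow_pos (norm_pos_iff.2 (sub_ne_zero.2 hwz)) _
    simp only [hwv] at hle
    rw [inv_mul_le_iff₀ hpos] at hle
    refine hle.trans (le_of_eq ?_)
    rw [div_pow]; ring
  have hlim : Tendsto (fun n : ℕ => 4 * R * C * (‖w - z₀‖ / r) ^ n) atTop (𝓝 (4 * R * C * 0)) :=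
    (tendsto_pow_atTop_nhds_zero_of_lt_one (by positivity) ((div_lt_one hr).2 hw)).const_mul _
  have := ge_of_tendsto' hlim key
  rw [mul_zero] at this
  exact norm_le_zero_iff.1 this

lemma aux_local [CompleteSpace E] (F : ℂ → E) (z₀ : ℂ) (R M : ℝ) (hR : 0 < R)
    (hF : ContDiffOn ℝ 1 F (Metric.ball z₀ (2 * R)))
    (hRM : 4 * R * M ≤ 1) (hM : 0 ≤ M)
    (h0 : ∀ᶠ z in 𝓝 z₀, F z = 0)
    (hd : ∀ z ∈ Metric.ball z₀ (2 * R), ‖fderiv ℝ F z 1 + I • fderiv ℝ F z I‖ ≤ M * ‖F z‖)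
    (w : ℂ) (hw : ‖w - z₀‖ < R / 2) : F w = 0 := by
  let χ : ContDiffBump z₀ := ⟨R / 2, R, by positivity, by linarith⟩
  set u : ℂ → E := fun z => (χ z) • F z with hu
  have heq : ∀ z, ‖z - z₀‖ < R / 2 → u =ᶠ[𝓝 z] F := by
    intro z hz
    have : Metric.ball z₀ (R / 2) ∈ 𝓝 z :=
      Metric.isOpen_ball.mem_nhds (by simpa [dist_eq_norm] using hz)
    filter_upwards [this] with y hy
    have : χ y = 1 := χ.one_of_mem_closedBall (Metric.ball_subset_closedBall hy)
    simp [hu, this]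
  have hsupp : ∀ z, R ≤ ‖z - z₀‖ → u z = 0 := by
    intro z hz
    have : χ z = 0 := χ.zero_of_le_dist (by simpa [dist_eq_norm] using hz)
    simp [hu, this]
  have huC : ContDiff ℝ 1 u := by
    rw [contDiff_iff_contDiffAt]
    intro z
    by_cases hz : z ∈ Metric.ball z₀ (2 * R)
    · exact χ.contDiffAt.smul (hF.contDiffAt (Metric.isOpen_ball.mem_nhds hz))
    · have : (Metric.closedBall z₀ R)ᶜ ∈ 𝓝 z := by
        refine Metric.isClosed_closedBall.isOpen_compl.mem_nhds ?_
        simp only [Metric.mem_ball, Set.mem_compl_iff, Metric.mem_closedBall] at hz ⊢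
        linarith
      have h2 : u =ᶠ[𝓝 z] fun _ => 0 := by
        filter_upwards [this] with y hy
        apply hsupp
        simp only [Set.mem_compl_iff, Metric.mem_closedBall, dist_eq_norm] at hy
        linarith
      exact contDiffAt_const.congr_of_eventuallyEq h2
  have := aux_uc u huC z₀ R (R / 2) M hR (by positivity) hRM hM hsupp
    (by filter_upwards [h0] with z hz; simp [hu, hz])
    (fun z hz => by
      rw [(heq z hz).fderiv_eq, (heq z hz).eq_of_nhds]
      apply hd
      rw [Metric.mem_ball, dist_eq_norm]; linarith) w hw
  rw [← (heq w hw).eq_of_nhds]; exact this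

lemma aux_global [CompleteSpace E] (F : ℂ → E) (U : Set ℂ) (hU : IsOpen U) (hUc : IsPreconnected U)
    (hF : ContDiffOn ℝ 1 F U) (N : ℂ → ℝ) (hN : ContinuousOn N U)
    (hd : ∀ z ∈ U, ‖fderiv ℝ F z 1 + I • fderiv ℝ F z I‖ ≤ N z * ‖F z‖)
    (a : ℂ) (ha : a ∈ U) (h0 : ∀ᶠ z in 𝓝 a, F z = 0) (w : ℂ) (hw : w ∈ U) : F w = 0 := by
  have hS : IsOpen {z | ∀ᶠ y in 𝓝 z, F y = 0} := isOpen_setOfPred_eventually_nhds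
  have := hUc.subset_of_closure_inter_subset hS ⟨a, ha, h0⟩ ?_
  · exact (this hw).self_of_nhds
  rintro z ⟨hz, hzU⟩
  -- bound near z
  have hev : ∀ᶠ y in 𝓝 z, y ∈ U ∧ N y < |N z| + 1 :=
    (hU.eventually_mem hzU).and ((hN.continuousAt (hU.mem_nhds hzU)).eventually_lt_const
      (by linarith [le_abs_self (N z)]))
  obtain ⟨ε, hε, hball⟩ := Metric.eventually_nhds_iff_ball.1 hev
  set M := |N z| + 1 with hM
  have hMpos : 0 < M := by positivity
  obtain ⟨R, hR, hR1, hR2⟩ : ∃ R : ℝ, 0 < R ∧ 4 * R * M ≤ 1 ∧ 3 * R ≤ ε := by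
    refine ⟨min (1 / (4 * M)) (ε / 3), by positivity, ?_, ?_⟩
    · have := min_le_left (1 / (4 * M)) (ε / 3)
      rw [le_div_iff₀ (by positivity)] at this
      linarith
    · have := min_le_right (1 / (4 * M)) (ε / 3)
      linarith
  obtain ⟨z₀, hz₀, hdist⟩ := Metric.mem_closure_iff.1 hz (R / 4) (by positivity)
  have hsub : Metric.ball z₀ (2 * R) ⊆ Metric.ball z ε := by
    apply Metric.ball_subset_ball'
    rw [dist_comm]; linarith
  have hloc := aux_local F z₀ R M hR (hF.mono fun y hy => (hball y (hsub hy)).1) hR1 hMpos.le hz₀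
    (fun y hy => (hd y (hball y (hsub hy)).1).trans
      (by gcongr; exact (hball y (hsub hy)).2.le))
  have hmem : Metric.ball z₀ (R / 2) ∈ 𝓝 z :=
    Metric.isOpen_ball.mem_nhds (by rw [Metric.mem_ball]; linarith)
  show ∀ᶠ y in 𝓝 z, F y = 0
  filter_upwards [hmem] with y hy
  exact hloc y (by rwa [Metric.mem_ball, dist_eq_norm] at hy)

end aux

lemma dbar_zero_of_ev {f : ℂ → ℂ} {z : ℂ} (h : ∀ᶠ y in 𝓝 z, f y = 0) : dbar f z = 0 := by
  have : f =ᶠ[𝓝 z] fun _ => 0 := h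
  simp [dbar, this.fderiv_eq]

theorem stmt_13 (U : Set ℂ) (hU : IsOpen U) (hUconn : IsConnected U)
    (ν h p q : ℂ → ℂ)
    (hν : ContDiffOn ℝ (⊤ : ℕ∞) ν U) (hh : ContDiffOn ℝ (⊤ : ℕ∞) h U)
    (hp : ContDiffOn ℝ (⊤ : ℕ∞) p U) (hq : ContDiffOn ℝ (⊤ : ℕ∞) q U)
    (eh : ∀ z ∈ U, dbar h z = -p z)
    (ep : ∀ z ∈ U, dbar p z = -(ν z * h z) - q z)
    (eq : ∀ z ∈ U, dbar q z = -(ν z * p z))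
    (ePhi : ∀ z ∈ U, h z * q z - (1 / 2 : ℂ) * (p z) ^ 2 = 0) :
    (∀ z ∈ U, h z = 0) ∨ interior {z : ℂ | h z = 0} ∩ U = ∅ := by
  rw [or_iff_not_imp_right]
  intro hne
  obtain ⟨a, ha, haU⟩ := Set.nonempty_iff_ne_empty.2 hne
  have hUa := hU.mem_nhds haU
  have h0 : ∀ᶠ z in 𝓝 a, h z = 0 := mem_interior_iff_mem_nhds.1 ha
  have p0 : ∀ᶠ z in 𝓝 a, p z = 0 := by
    filter_upwards [h0.eventually_nhds, hUa] with z hz hzU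
    have := eh z hzU
    rw [dbar_zero_of_ev hz] at this
    simpa using this.symm
  have q0 : ∀ᶠ z in 𝓝 a, q z = 0 := by
    filter_upwards [p0.eventually_nhds, h0, hUa] with z hz hz' hzU
    have := ep z hzU
    rw [dbar_zero_of_ev hz, hz'] at this
    simpa using this.symm
  have hle : (1 : WithTop ℕ∞) ≤ ((⊤ : ℕ∞) : WithTop ℕ∞) := by exact_mod_cast le_top
  have hF : ContDiffOn ℝ 1 (fun z => (h z, p z, q z)) U :=
    (hh.of_le hle).prodMk ((hp.of_le hle).prodMk (hq.of_le hle))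
  have hdiff : ∀ {f : ℂ → ℂ}, ContDiffOn ℝ (⊤ : ℕ∞) f U → ∀ z ∈ U, DifferentiableAt ℝ f z :=
    fun hf z hz => ((hf.of_le hle).differentiableOn (by norm_num)).differentiableAt
      (hU.mem_nhds hz)
  have hdb : ∀ (f : ℂ → ℂ) z, fderiv ℝ f z 1 + I * fderiv ℝ f z I = 2 * dbar f z := by
    intro f z; rw [dbar]; ring
  have main := aux_global (fun z => (h z, p z, q z)) U hU hUconn.isPreconnected hF
    (fun z => 2 * (‖ν z‖ + 1)) (by have := hν.continuousOn; fun_prop) ?_ a haU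
    (by filter_upwards [h0, p0, q0] with z h1 h2 h3; simp [h1, h2, h3])
  · intro z hz
    have := main z hz
    simp only [Prod.mk_eq_zero] at this
    exact this.1
  intro z hz
  have hfd := ((hdiff hh z hz).hasFDerivAt.prodMk
    ((hdiff hp z hz).hasFDerivAt.prodMk (hdiff hq z hz).hasFDerivAt)).fderiv
  have hval : fderiv ℝ (fun z => (h z, p z, q z)) z 1 + I • fderiv ℝ (fun z => (h z, p z, q z)) z I
      = (2 * dbar h z, 2 * dbar p z, 2 * dbar q z) := by
    rw [hfd, ← hdb, ← hdb, ← hdb]; rfl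
  rw [hval, eh z hz, ep z hz, eq z hz]
  set X := ‖(h z, p z, q z)‖ with hX
  have hh' : ‖h z‖ ≤ X := norm_fst_le (h z, p z, q z)
  have hpq : ‖(p z, q z)‖ ≤ X := norm_snd_le (h z, p z, q z)
  have hp' : ‖p z‖ ≤ X := (norm_fst_le (p z, q z)).trans hpq
  have hq' : ‖q z‖ ≤ X := (norm_snd_le (p z, q z)).trans hpq
  have hn := norm_nonneg (ν z)
  have hX0 : 0 ≤ X := norm_nonneg _
  have hnX : 0 ≤ ‖ν z‖ * X := by positivity
  have h1 : ‖ν z‖ * ‖h z‖ ≤ ‖ν z‖ * X := by gcongr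
  have h2 : ‖ν z‖ * ‖p z‖ ≤ ‖ν z‖ * X := by gcongr
  refine norm_prod_le_iff.2 ⟨?_, norm_prod_le_iff.2 ⟨?_, ?_⟩⟩
  · simp only [norm_mul, norm_neg, Complex.norm_ofNat]; nlinarith
  · have := norm_sub_le (-(ν z * h z)) (q z)
    rw [norm_neg, norm_mul] at this
    simp only [norm_mul, Complex.norm_ofNat]; nlinarith
  · simp only [norm_mul, norm_neg, Complex.norm_ofNat]; nlinarith
end
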